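/- arXiv:math/0411468 — 3 statements merged into one kernel-verified Lean document; each statement's English description precedes it below -/
import Mathlib

section
/- Let G₀, G₁ be groups, s, t : G₁ → G₀ group homomorphisms, and ι : G₀ → G₁ a group homomorphism with s(ι(x)) = x and t(ι(x)) = x for all x ∈ G₀. Define c(a,b) := a · ι(s(a))⁻¹ · b for all a, b ∈ G₁ with s(a) = t(b). Then: (i) s(c(a,b)) = s(b) and t(c(a,b)) = t(a); (ii) c(ι(t(b)), b) = b and c(a, ι(s(a))) = a (unit laws); (iii) c(c(a,b), d) = c(a, c(b,d)) whenever s(a) = t(b) and s(b) = t(d) (associativity). -/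
/-- Given the data `(G₀, G₁, s, t, ι)` of a would-be internal category in `Grp`,
the formula `c(a,b) = a * ι(s a)⁻¹ * b` defines a composition satisfying the
source/target compatibility, unit and associativity axioms. -/
theorem vertical_composition_exists {G₀ G₁ : Type*} [Group G₀] [Group G₁]
    (s t : G₁ →* G₀) (ι : G₀ →* G₁)
    (hs : ∀ x : G₀, s (ι x) = x) (ht : ∀ x : G₀, t (ι x) = x) :
    (∀ a b : G₁, s a = t b → s (a * (ι (s a))⁻¹ * b) = s b) ∧
    (∀ a b : G₁, s a = t b → t (a * (ι (s a))⁻¹ * b) = t a) ∧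
    (∀ b : G₁, ι (t b) * (ι (s (ι (t b))))⁻¹ * b = b) ∧
    (∀ a : G₁, a * (ι (s a))⁻¹ * ι (s a) = a) ∧
    (∀ a b d : G₁, s a = t b → s b = t d →
      (a * (ι (s a))⁻¹ * b) * (ι (s (a * (ι (s a))⁻¹ * b)))⁻¹ * d =
        a * (ι (s a))⁻¹ * (b * (ι (s b))⁻¹ * d)) := by
  have source_comp (a b : G₁) : s (a * (ι (s a))⁻¹ * b) = s b := by simp [hs]
  refine ⟨fun a b _ => source_comp a b, fun a b h => ?_, fun b => ?_, fun a => ?_,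
    fun a b d _ _ => ?_⟩
  · simp [ht, h]
  · simp [hs]
  · simp
  · rw [source_comp]
    simp only [mul_assoc]
end

section
/- Let G₀, G₁ be groups, s, t : G₁ → G₀ group homomorphisms, and ι : G₀ → G₁ a group homomorphism with s(ι(x)) = x and t(ι(x)) = x for all x ∈ G₀. Let P = {(a,b) ∈ G₁ × G₁ : s(a) = t(b)} be the pullback subgroup of G₁ × G₁, and define c : P → G₁ by c(a,b) := a · ι(s(a))⁻¹ · b. Then c is a group homomorphism (equivalently, the interchange law c(a₁a₂, b₁b₂) = c(a₁,b₁)·c(a₂,b₂) holds for all composable pairs) if and only if every element of ker s commutes with every element of ker t, i.e. u·v = v·u for all u, v ∈ G₁ with s(u) = 1 and t(v) = 1. -/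
/-- The canonical vertical composition `c(a,b) = a * ι(s a)⁻¹ * b` on composable
pairs is a group homomorphism on the pullback subgroup (equivalently, satisfies
the interchange law) if and only if every element of `ker s` commutes with
every element of `ker t`. -/
theorem vertical_composition_hom_iff_kernels_commute {G₀ G₁ : Type*} [Group G₀] [Group G₁]
    (s t : G₁ →* G₀) (ι : G₀ →* G₁)
    (hs : ∀ x : G₀, s (ι x) = x) (ht : ∀ x : G₀, t (ι x) = x) :
    (∀ a₁ a₂ b₁ b₂ : G₁, s a₁ = t b₁ → s a₂ = t b₂ →
      (a₁ * a₂) * (ι (s (a₁ * a₂)))⁻¹ * (b₁ * b₂) =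
        (a₁ * (ι (s a₁))⁻¹ * b₁) * (a₂ * (ι (s a₂))⁻¹ * b₂)) ↔
    (∀ u v : G₁, s u = 1 → t v = 1 → u * v = v * u) := by
  constructor
  · intro h u v hu hv
    simpa [hu] using h 1 u v 1 (by simp [hv]) (by simp [hu])
  · intro h a₁ a₂ b₁ b₂ h₁ _
    have key := h (a₂ * (ι (s a₂))⁻¹) ((ι (s a₁))⁻¹ * b₁) (by simp [hs]) (by simp [ht, h₁])
    calc (a₁ * a₂) * (ι (s (a₁ * a₂)))⁻¹ * (b₁ * b₂)
        = a₁ * ((a₂ * (ι (s a₂))⁻¹) * ((ι (s a₁))⁻¹ * b₁)) * b₂ := by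
          simp only [map_mul, mul_inv_rev, mul_assoc]
      _ = (a₁ * (ι (s a₁))⁻¹ * b₁) * (a₂ * (ι (s a₂))⁻¹ * b₂) := by
          rw [key]
          simp only [mul_assoc]
end

section
/- Let k be a field, H₀ a bialgebra over k, and H₁ a commutative Hopf algebra over k with antipode S, comultiplication Δ and multiplication μ. Let σ, τ : H₀ → H₁ and ε̲ : H₁ → H₀ be bialgebra homomorphisms with ε̲ ∘ σ = id_{H₀} and ε̲ ∘ τ = id_{H₀}. Define the k-linear map S̲ : H₁ → H₁ by S̲(h) = Σ σ(ε̲(h₍₁₎)) · S(h₍₂₎) · τ(ε̲(h₍₃₎)) in Sweedler notation (i.e. S̲ is the composite of Δ applied twice with (σ∘ε̲) ⊗ S ⊗ (τ∘ε̲) followed by iterated multiplication). Then S̲ is an algebra homomorphism and satisfies S̲ ∘ τ = σ and S̲ ∘ σ = τ. -/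
open TensorProduct

/-- The 'vertical antipode' `S̲(h) = Σ σ(ε̲(h₍₁₎)) · S(h₍₂₎) · τ(ε̲(h₍₃₎))` of a
commutative cotrialgebra, as a linear map. -/
noncomputable def vertAntipode (k : Type*) [CommSemiring k] {H₀ H₁ : Type*}
    [Semiring H₀] [Bialgebra k H₀] [Semiring H₁] [HopfAlgebra k H₁]
    (σ τ : H₀ →ₐc[k] H₁) (e : H₁ →ₐc[k] H₀) : H₁ →ₗ[k] H₁ :=
  LinearMap.mul' k H₁ ∘ₗ
    TensorProduct.map LinearMap.id (LinearMap.mul' k H₁) ∘ₗ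
    TensorProduct.map ((σ : H₀ →ₗ[k] H₁) ∘ₗ (e : H₁ →ₗ[k] H₀))
      (TensorProduct.map (HopfAlgebra.antipode (R := k))
        ((τ : H₀ →ₗ[k] H₁) ∘ₗ (e : H₁ →ₗ[k] H₀))) ∘ₗ
    TensorProduct.map LinearMap.id (Coalgebra.comul (R := k)) ∘ₗ
    Coalgebra.comul (R := k)

open WithConv HopfAlgebra

section

variable {k H₀ H₁ : Type*} [CommSemiring k] [Semiring H₀] [Bialgebra k H₀]

theorem vertAntipode_eq_convMul [Semiring H₁] [HopfAlgebra k H₁]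
    (σ τ : H₀ →ₐc[k] H₁) (e : H₁ →ₐc[k] H₀) :
    vertAntipode k σ τ e =
      (toConv ((σ : H₀ →ₗ[k] H₁) ∘ₗ (e : H₁ →ₗ[k] H₀)) *
        (toConv (antipode k) * toConv ((τ : H₀ →ₗ[k] H₁) ∘ₗ (e : H₁ →ₗ[k] H₀)))).ofConv := by
  simp only [LinearMap.convMul_def, vertAntipode, ofConv_toConv]
  ext x
  simp only [LinearMap.comp_apply]
  congr 1
  generalize Coalgebra.comul (R := k) x = z
  induction z with
  | zero => simp
  | add a b ha hb => simp only [map_add, ha, hb]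
  | tmul a b => rfl

/-- Precomposing the antipode with a coalgebra map gives a left convolution inverse of that
map. -/
theorem antipode_comp_convMul_self [Semiring H₁] [HopfAlgebra k H₁] (τ : H₀ →ₐc[k] H₁) :
    toConv (antipode k ∘ₗ (τ : H₀ →ₗ[k] H₁)) * toConv (τ : H₀ →ₗ[k] H₁) = 1 := by
  have h := LinearMap.convMul_comp_coalgHom_distrib (toConv (antipode k (A := H₁)))
    (toConv LinearMap.id) (τ : H₀ →ₗc[k] H₁)
  rw [LinearMap.antipode_mul_id] at h
  ext x
  refine (LinearMap.congr_fun h x).symm.trans ?_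
  simp

/-- Precomposing the antipode with a coalgebra map gives a right convolution inverse of that
map. -/
theorem convMul_antipode_comp_self [Semiring H₁] [HopfAlgebra k H₁] (τ : H₀ →ₐc[k] H₁) :
    toConv (τ : H₀ →ₗ[k] H₁) * toConv (antipode k ∘ₗ (τ : H₀ →ₗ[k] H₁)) = 1 := by
  have h := LinearMap.convMul_comp_coalgHom_distrib (toConv LinearMap.id)
    (toConv (antipode k (A := H₁))) (τ : H₀ →ₗc[k] H₁)
  rw [LinearMap.id_mul_antipode] at h
  ext x
  refine (LinearMap.congr_fun h x).symm.trans ?_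
  simp

theorem vertAntipode_comp [Semiring H₁] [HopfAlgebra k H₁]
    (σ τ f : H₀ →ₐc[k] H₁) (e : H₁ →ₐc[k] H₀) (hf : ∀ x, e (f x) = x) :
    vertAntipode k σ τ e ∘ₗ (f : H₀ →ₗ[k] H₁) =
      (toConv (σ : H₀ →ₗ[k] H₁) * (toConv (antipode k ∘ₗ (f : H₀ →ₗ[k] H₁)) *
        toConv (τ : H₀ →ₗ[k] H₁))).ofConv := by
  have hef : (e : H₁ →ₗ[k] H₀) ∘ₗ (f : H₀ →ₗ[k] H₁) = LinearMap.id := LinearMap.ext hf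
  have hcomp (g : H₀ →ₐc[k] H₁) :
      ((g : H₀ →ₗ[k] H₁) ∘ₗ (e : H₁ →ₗ[k] H₀)) ∘ₗ (f : H₀ →ₗ[k] H₁) = g := by
    rw [LinearMap.comp_assoc, hef, LinearMap.comp_id]
  have hdistrib (a b : WithConv (H₁ →ₗ[k] H₁)) :
      (a * b).ofConv ∘ₗ (f : H₀ →ₗ[k] H₁) =
        (toConv (a.ofConv ∘ₗ (f : H₀ →ₗ[k] H₁)) *
          toConv (b.ofConv ∘ₗ (f : H₀ →ₗ[k] H₁))).ofConv :=
    LinearMap.convMul_comp_coalgHom_distrib a b (f : H₀ →ₗc[k] H₁)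
  rw [vertAntipode_eq_convMul, hdistrib, hdistrib, hcomp, hcomp]

end

/-- For a commutative Hopf algebra `H₁` with bialgebra homomorphisms
`σ, τ : H₀ → H₁` and `ε̲ : H₁ → H₀` satisfying `ε̲ ∘ σ = id` and `ε̲ ∘ τ = id`,
the map `S̲(h) = Σ σ(ε̲(h₍₁₎)) · S(h₍₂₎) · τ(ε̲(h₍₃₎))` is an algebra
homomorphism and satisfies `S̲ ∘ τ = σ` and `S̲ ∘ σ = τ`. -/
theorem vertAntipode_algHom_and_swaps {k H₀ H₁ : Type*} [Field k]
    [Ring H₀] [Bialgebra k H₀] [CommRing H₁] [HopfAlgebra k H₁]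
    (σ τ : H₀ →ₐc[k] H₁) (e : H₁ →ₐc[k] H₀)
    (heσ : ∀ x : H₀, e (σ x) = x) (heτ : ∀ x : H₀, e (τ x) = x) :
    (vertAntipode k σ τ e 1 = 1) ∧
    (∀ x y : H₁, vertAntipode k σ τ e (x * y) =
      vertAntipode k σ τ e x * vertAntipode k σ τ e y) ∧
    (∀ x : H₀, vertAntipode k σ τ e (τ x) = σ x) ∧
    (∀ x : H₀, vertAntipode k σ τ e (σ x) = τ x) := by
  let g : H₁ →ₐ[k] H₁ := (toConv ((σ : H₀ →ₐ[k] H₁).comp (e : H₁ →ₐ[k] H₀)) *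
    (toConv (antipodeAlgHom k H₁) * toConv ((τ : H₀ →ₐ[k] H₁).comp (e : H₁ →ₐ[k] H₀)))).ofConv
  have hg : vertAntipode k σ τ e = g.toLinearMap := by
    rw [vertAntipode_eq_convMul]
    rfl
  refine ⟨?_, ?_, fun x => ?_, fun x => ?_⟩
  · rw [hg]; exact map_one g
  · rw [hg]; exact map_mul g
  · have := LinearMap.congr_fun (vertAntipode_comp σ τ τ e heτ) x
    rw [antipode_comp_convMul_self, mul_one] at this
    exact this
  · have := LinearMap.congr_fun (vertAntipode_comp σ τ σ e heσ) x
    rw [← mul_assoc, convMul_antipode_comp_self, one_mul] at this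
    exact this
end
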